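/- Let d ≥ 2, q ≥ 2, α > d, J > 0, β > 0, and let φ : ZMod q → ℝ have all Fourier coefficients nonnegative reals. For finite Λ ⊂ ℤ^d and nonnegative field (h_x)_{x∈Λ}, define H^q_{Λ,h}(σ) = −∑_{{x,y}⊆Λ} J_{xy} φ(σ_x−σ_y) − ∑_{x∈Λ}∑_{y∉Λ} J_{xy} φ(σ_x) − ∑_{x∈Λ} h_x φ(σ_x) on Ω_Λ^0, and ⟨f⟩^q_{Λ,β,h} = (∑_{σ∈Ω_Λ^0} f(σ|_Λ) e^{−βH^q_{Λ,h}(σ)})/(∑_{σ∈Ω_Λ^0} e^{−βH^q_{Λ,h}(σ)}). Let f : (Λ → ZMod q) → ℝ have nonnegative Fourier transform. Then: (1) for every z ∈ Λ, if h and h' are nonnegative fields on Λ with h_x = h'_x for x ≠ z and h_z ≤ h'_z, then ⟨f⟩^q_{Λ,β,h} ≤ ⟨f⟩^q_{Λ,β,h'}; (2) for every finite Δ with Λ ⊆ Δ ⊂ ℤ^d and every nonnegative field h on Δ, ⟨f⟩^q_{Δ,β,h} ≤ ⟨f⟩^q_{Λ,β,h|_Λ}, where on the left f is viewed as the Δ-local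 function σ ↦ f(σ|_Λ). -/

import Mathlib

open scoped BigOperators

noncomputable section

/-- The lattice `ℤ^d`. -/
abbrev Zd (d : ℕ) := Fin d → ℤ

/-- The ℓ¹-norm on `ℤ^d`. -/
def l1 {d : ℕ} (x : Zd d) : ℤ := ∑ i, |x i|

/-- Long-range couplings `J_{xy} = J / |x-y|^α` for `x ≠ y`, and `J_{xx} = 0`. -/
noncomputable def Jcoup (d : ℕ) (J α : ℝ) (x y : Zd d) : ℝ :=
  if x = y then 0 else J / ((l1 (x - y) : ℝ) ^ α)

/-- The configuration in `Ω_Λ^0` determined by `σ : Λ → ZMod q`. -/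
def extendCfg {d q : ℕ} (Λ : Finset (Zd d)) (σ : Λ → ZMod q) : Zd d → ZMod q :=
  fun x => if hx : x ∈ Λ then σ ⟨x, hx⟩ else 0

/-- The Hamiltonian `H^q_{Λ,h}(σ) = -∑_{{x,y}⊆Λ} J_{xy} φ(σ_x-σ_y)
    - ∑_{x∈Λ}∑_{y∉Λ} J_{xy} φ(σ_x) - ∑_{x∈Λ} h_x φ(σ_x)`, with boundary colour `0`
    (the paper's colour `q`). -/
noncomputable def hamField (d q : ℕ) (J α : ℝ) (φ : ZMod q → ℝ) (Λ : Finset (Zd d))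
    (h : Λ → ℝ) (σ : Zd d → ZMod q) : ℝ :=
  -(1 / 2) * (∑ x ∈ Λ, ∑ y ∈ Λ, Jcoup d J α x y * φ (σ x - σ y))
    - ∑ x ∈ Λ.attach, ∑' y : Zd d, (if y ∈ Λ then 0 else Jcoup d J α x y * φ (σ x))
    - ∑ x ∈ Λ.attach, h x * φ (σ x)

/-- The finite-volume expectation `⟨f⟩^q_{Λ,β,h}`. -/
noncomputable def expec (d q : ℕ) [NeZero q] (J α β : ℝ) (φ : ZMod q → ℝ)
    (Λ : Finset (Zd d)) (h : Λ → ℝ) (f : (Λ → ZMod q) → ℝ) : ℝ :=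
  (∑ σ : Λ → ZMod q, f σ * Real.exp (-(β * hamField d q J α φ Λ h (extendCfg Λ σ))))
    / (∑ σ : Λ → ZMod q, Real.exp (-(β * hamField d q J α φ Λ h (extendCfg Λ σ))))

/-- The `k`-th Fourier coefficient of `f : ZMod q → ℝ`. -/
noncomputable def ftZMod {q : ℕ} [NeZero q] (f : ZMod q → ℝ) (k : ZMod q) : ℂ :=
  ∑ n : ZMod q, (f n : ℂ) *
    Complex.exp (-(2 * (Real.pi : ℂ) * Complex.I * ((k.val * n.val : ℕ) : ℂ)) / (q : ℂ))

/-- The Fourier coefficient, indexed by `k : ι → ZMod q`, of a function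
`f : (ι → ZMod q) → ℝ` on a finite product of copies of `ZMod q`:
`f̂(k) = ∑_σ f(σ)·exp(−(2πi/q)·∑_x k(x).val·σ(x).val)`. -/
noncomputable def ftPi {q : ℕ} [NeZero q] {ι : Type*} [Fintype ι] [DecidableEq ι]
    (f : (ι → ZMod q) → ℝ) (k : ι → ZMod q) : ℂ :=
  ∑ σ : ι → ZMod q, (f σ : ℂ) *
    Complex.exp (-(2 * (Real.pi : ℂ) * Complex.I *
      ((∑ x : ι, (k x).val * (σ x).val : ℕ) : ℂ)) / (q : ℂ))

section PosSemidefKernel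

variable {n : Type*} [Fintype n]

lemma posSemidef_real_iff {K : Matrix n n ℝ} :
    K.PosSemidef ↔ (∀ i j, K i j = K j i) ∧ ∀ x : n → ℝ, 0 ≤ ∑ i, ∑ j, x i * x j * K i j := by
  rw [Matrix.posSemidef_iff_dotProduct_mulVec]
  refine and_congr ?_ (forall_congr' fun x => ?_)
  · rw [Matrix.IsHermitian.ext_iff]
    exact ⟨fun h i j => h j i, fun h i j => h j i⟩
  · have : star x ⬝ᵥ K.mulVec x = ∑ i, ∑ j, x i * x j * K i j := by
      simp only [dotProduct, Matrix.mulVec, Finset.mul_sum, Pi.star_apply, star_trivial]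
      exact Finset.sum_congr rfl fun i _ => Finset.sum_congr rfl fun j _ => by ring
    rw [this]

lemma posSemidef_of_const {c : ℝ} (hc : 0 ≤ c) :
    (Matrix.of fun _ _ : n => c).PosSemidef := by
  refine posSemidef_real_iff.2 ⟨fun _ _ => rfl, fun x => ?_⟩
  have : ∑ i, ∑ j, x i * x j * c = c * (∑ i, x i) ^ 2 := by
    rw [sq, Finset.sum_mul_sum, Finset.mul_sum]
    exact Finset.sum_congr rfl fun i _ => by
      rw [Finset.mul_sum]
      exact Finset.sum_congr rfl fun j _ => by ring
  simpa [this] using mul_nonneg hc (sq_nonneg _)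

lemma posSemidef_map_pow {K : Matrix n n ℝ} (hK : K.PosSemidef) (m : ℕ) :
    (Matrix.of fun i j => K i j ^ m).PosSemidef := by
  induction m with
  | zero => simpa using posSemidef_of_const (n := n) zero_le_one
  | succ m ih =>
    have h : (Matrix.of fun i j => K i j ^ (m + 1))
        = (Matrix.of fun i j => K i j ^ m).hadamard K := by
      ext i j
      simp [pow_succ]
    rw [h]
    exact ih.hadamard hK

lemma posSemidef_map_exp {K : Matrix n n ℝ} (hK : K.PosSemidef) :
    (Matrix.of fun i j => Real.exp (K i j)).PosSemidef := by
  refine posSemidef_real_iff.2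
    ⟨fun i j => congrArg Real.exp ((posSemidef_real_iff.1 hK).1 i j), fun x => ?_⟩
  have hexp : ∀ t : ℝ, HasSum (fun m : ℕ => t ^ m / (m.factorial : ℝ)) (Real.exp t) := fun t => by
    rw [Real.exp_eq_exp_ℝ]
    exact NormedSpace.expSeries_div_hasSum_exp t
  have hsum : HasSum (fun m : ℕ => ∑ i, ∑ j, x i * x j * (K i j ^ m / (m.factorial : ℝ)))
      (∑ i, ∑ j, x i * x j * Real.exp (K i j)) :=
    hasSum_sum fun i _ => hasSum_sum fun j _ => (hexp (K i j)).mul_left _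
  refine hsum.nonneg fun m => ?_
  have := (posSemidef_real_iff.1 (posSemidef_map_pow hK m)).2 x
  simp only [Matrix.of_apply] at this
  simpa only [← mul_div_assoc, ← Finset.sum_div] using div_nonneg this (Nat.cast_nonneg _)

end PosSemidefKernel

section PositiveDefiniteFunctions

variable {G G' : Type*} [AddCommGroup G] [AddCommGroup G']

/-- A real function `f` on an abelian group is positive definite if the kernel `f (u - v)` is. -/
def IsPosDefFun (f : G → ℝ) : Prop := (Matrix.of fun u v => f (u - v)).PosSemidef

/-- A function on the duplicated group `G × G` all of whose kernels
`(u, v) ↦ F (u + v + c, u - v)` are positive semidefinite. -/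
def IsDupPos (F : G → G → ℝ) : Prop :=
  ∀ c, (Matrix.of fun u v => F (u + v + c) (u - v)).PosSemidef

namespace IsPosDefFun

lemma comp_hom {f : G → ℝ} (hf : IsPosDefFun f) (e : G' →+ G) :
    IsPosDefFun fun σ => f (e σ) := by
  have h : (Matrix.of fun u v => f (e (u - v)))
      = (Matrix.of fun u v => f (u - v)).submatrix e e := by
    ext u v
    simp
  rw [IsPosDefFun, h]
  exact hf.submatrix e

lemma add {f g : G → ℝ} (hf : IsPosDefFun f) (hg : IsPosDefFun g) :
    IsPosDefFun fun σ => f σ + g σ :=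
  Matrix.PosSemidef.add hf hg

lemma const_mul {f : G → ℝ} (hf : IsPosDefFun f) {c : ℝ} (hc : 0 ≤ c) :
    IsPosDefFun fun σ => c * f σ :=
  Matrix.PosSemidef.smul hf hc

lemma sum {ι : Type*} (s : Finset ι) {f : ι → G → ℝ} (hf : ∀ i ∈ s, IsPosDefFun (f i)) :
    IsPosDefFun fun σ => ∑ i ∈ s, f i σ := by
  have h : (Matrix.of fun u v => ∑ i ∈ s, f i (u - v))
      = ∑ i ∈ s, Matrix.of fun u v => f i (u - v) := by
    ext u v
    simp [Matrix.sum_apply]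
  rw [IsPosDefFun, h]
  exact Matrix.posSemidef_sum s hf

variable [Fintype G]

lemma exp {f : G → ℝ} (hf : IsPosDefFun f) : IsPosDefFun fun σ => Real.exp (f σ) :=
  posSemidef_map_exp hf

lemma even {f : G → ℝ} (hf : IsPosDefFun f) (σ : G) : f (-σ) = f σ := by
  simpa using (posSemidef_real_iff.1 hf).1 0 σ

/-- The indicator function of a subgroup is positive definite. -/
lemma indicator_ker [DecidableEq G'] (e : G →+ G') :
    IsPosDefFun fun σ => if e σ = 0 then (1 : ℝ) else 0 := by
  classical
  refine posSemidef_real_iff.2 ⟨fun u v => ?_, fun x => ?_⟩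
  · simp only [Matrix.of_apply, map_sub, sub_eq_zero, @eq_comm _ (e v)]
  · have h : ∑ u, ∑ v, x u * x v * (if e (u - v) = 0 then (1 : ℝ) else 0)
        = ∑ a ∈ Finset.univ.image e, (∑ u, if e u = a then x u else 0) ^ 2 := by
      simp only [sq, Finset.sum_mul_sum]
      symm
      rw [Finset.sum_comm]
      refine Finset.sum_congr rfl fun u _ => ?_
      rw [Finset.sum_comm]
      refine Finset.sum_congr rfl fun v _ => ?_
      rw [Finset.sum_eq_single (e u)]
      · by_cases h : e v = e u
        · simp [h]
        · have h' : ¬ e u - e v = 0 := fun h' => h (sub_eq_zero.1 h').symm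
          simp [h, h']
      · intro b _ hb
        simp [hb.symm]
      · simp
    simp only [Matrix.of_apply]
    rw [h]
    exact Finset.sum_nonneg fun a _ => sq_nonneg _

/-- The reflection `v ↦ -v - c` commutes with the kernel `f (u - v)`, so its spectral parts
are positive semidefinite. -/
lemma isDupPos_reflection {f : G → ℝ} (hf : IsPosDefFun f) {ε : ℝ} (hε : ε ^ 2 = 1) :
    IsDupPos fun s t => f t + ε * f s := by
  intro c
  refine posSemidef_real_iff.2 ⟨fun u v => ?_, fun x => ?_⟩
  · simp only [Matrix.of_apply]
    rw [← hf.even (u - v), neg_sub, add_comm u v]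
  · simp only [Matrix.of_apply]
    let r : G ≃ G := (Equiv.neg G).trans (Equiv.subRight c)
    have hr : ∀ u, r u = -u - c := fun _ => rfl
    have hrr : ∀ u, r (r u) = u := fun u => by rw [hr, hr]; abel
    have key := (posSemidef_real_iff.1 hf).2 fun u => x u + ε * x (r u)
    simp only [Matrix.of_apply] at key
    have h1 : ∑ u, ∑ v, x (r u) * x (r v) * f (u - v) = ∑ u, ∑ v, x u * x v * f (u - v) := by
      rw [← Equiv.sum_comp r]
      refine Finset.sum_congr rfl fun u _ => ?_
      rw [← Equiv.sum_comp r]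
      refine Finset.sum_congr rfl fun v _ => ?_
      rw [hrr, hrr, ← hf.even, hr, hr, show -(-u - c - (-v - c)) = u - v by abel]
    have h2 : ∑ u, ∑ v, x u * x (r v) * f (u - v)
        = ∑ u, ∑ v, x u * x v * f (u + v + c) := by
      refine Finset.sum_congr rfl fun u _ => ?_
      rw [← Equiv.sum_comp r]
      refine Finset.sum_congr rfl fun v _ => ?_
      rw [hrr, hr, show u - (-v - c) = u + v + c by abel]
    have h3 : ∑ u, ∑ v, x (r u) * x v * f (u - v)
        = ∑ u, ∑ v, x u * x v * f (u + v + c) := by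
      rw [← Equiv.sum_comp r]
      refine Finset.sum_congr rfl fun u _ => ?_
      refine Finset.sum_congr rfl fun v _ => ?_
      rw [hrr, ← hf.even, hr, show -(-u - c - v) = u + v + c by abel]
    have h4 : ∑ u, ∑ v, (x u + ε * x (r u)) * (x v + ε * x (r v)) * f (u - v)
        = ∑ u, ∑ v, x u * x v * f (u - v) + ε * ∑ u, ∑ v, x u * x (r v) * f (u - v)
          + ε * ∑ u, ∑ v, x (r u) * x v * f (u - v)
          + ε ^ 2 * ∑ u, ∑ v, x (r u) * x (r v) * f (u - v) := by
      simp only [Finset.mul_sum, ← Finset.sum_add_distrib]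
      exact Finset.sum_congr rfl fun u _ => Finset.sum_congr rfl fun v _ => by ring
    have h5 : ∑ u, ∑ v, x u * x v * (f (u - v) + ε * f (u + v + c))
        = ∑ u, ∑ v, x u * x v * f (u - v) + ε * ∑ u, ∑ v, x u * x v * f (u + v + c) := by
      simp only [Finset.mul_sum, ← Finset.sum_add_distrib]
      exact Finset.sum_congr rfl fun u _ => Finset.sum_congr rfl fun v _ => by ring
    rw [h4, h1, h2, h3, hε] at key
    rw [h5]
    linarith

end IsPosDefFun

namespace IsDupPos

lemma mul {F K : G → G → ℝ} (hF : IsDupPos F) (hK : IsDupPos K) :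
    IsDupPos fun s t => F s t * K s t :=
  fun c => (hF c).hadamard (hK c)

variable [Fintype G]

lemma exp {F : G → G → ℝ} (hF : IsDupPos F) : IsDupPos fun s t => Real.exp (F s t) :=
  fun c => posSemidef_map_exp (hF c)

lemma sum_nonneg {F : G → G → ℝ} (hF : IsDupPos F) : 0 ≤ ∑ s, ∑ t, F s t := by
  have h : ∀ c, 0 ≤ ∑ u, ∑ v, F (u + v + c) (u - v) := fun c => by
    simpa using (posSemidef_real_iff.1 (hF c)).2 fun _ => 1
  have key : ∑ c, ∑ u, ∑ v, F (u + v + c) (u - v) = Fintype.card G * ∑ s, ∑ t, F s t := by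
    rw [Finset.sum_comm]
    have : ∀ u : G, ∑ c, ∑ v, F (u + v + c) (u - v) = ∑ s, ∑ t, F s t := fun u => by
      rw [Finset.sum_comm, Finset.sum_comm (f := fun s t => F s t),
        ← Equiv.sum_comp (Equiv.subLeft u) fun t => ∑ s, F s t]
      exact Finset.sum_congr rfl fun v _ => Equiv.sum_comp (Equiv.addLeft (u + v)) (F · (u - v))
    simp [this]
  have hpos : (0 : ℝ) < Fintype.card G := by exact_mod_cast Fintype.card_pos
  exact nonneg_of_mul_nonneg_right (key ▸ Finset.sum_nonneg fun c _ => h c) hpos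

end IsDupPos

/-- Ginibre's inequality on a finite abelian group. -/
theorem IsPosDefFun.ginibre [Fintype G] {f g A : G → ℝ} (hf : IsPosDefFun f)
    (hg : IsPosDefFun g) (hA : IsPosDefFun A) :
    (∑ σ, f σ * Real.exp (A σ)) * (∑ σ, g σ * Real.exp (A σ)) ≤
      (∑ σ, f σ * g σ * Real.exp (A σ)) * ∑ σ, Real.exp (A σ) := by
  have hm : ((-1 : ℝ)) ^ 2 = 1 := by norm_num
  have key := (((hf.isDupPos_reflection hm).mul (hg.isDupPos_reflection hm)).mul
    (hA.isDupPos_reflection (one_pow 2)).exp).sum_nonneg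
  have h : ∑ s, ∑ t, (f t + -1 * f s) * (g t + -1 * g s) * Real.exp (A t + 1 * A s)
      = (∑ σ, Real.exp (A σ)) * (∑ σ, f σ * g σ * Real.exp (A σ))
        - (∑ σ, g σ * Real.exp (A σ)) * (∑ σ, f σ * Real.exp (A σ))
        - (∑ σ, f σ * Real.exp (A σ)) * (∑ σ, g σ * Real.exp (A σ))
        + (∑ σ, f σ * g σ * Real.exp (A σ)) * ∑ σ, Real.exp (A σ) := by
    simp only [Finset.sum_mul_sum, ← Finset.sum_add_distrib, ← Finset.sum_sub_distrib]
    exact Finset.sum_congr rfl fun u _ => Finset.sum_congr rfl fun v _ => by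
      rw [Real.exp_add, one_mul]; ring
  rw [h] at key
  linarith

end PositiveDefiniteFunctions

section Fourier

lemma AddChar.map_finset_sum {A M ι : Type*} [AddCommMonoid A] [CommMonoid M] (ψ : AddChar A M)
    (s : Finset ι) (a : ι → A) : ψ (∑ i ∈ s, a i) = ∏ i ∈ s, ψ (a i) := by
  classical
  induction s using Finset.induction_on with
  | empty => simp
  | insert i s hi ih => rw [Finset.sum_insert hi, Finset.prod_insert hi, map_add_eq_mul, ih]

variable {q : ℕ} [NeZero q] {ι : Type*} [Fintype ι] [DecidableEq ι]

lemma ftPi_eq_sum_stdAddChar (f : (ι → ZMod q) → ℝ) (k : ι → ZMod q) :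
    ftPi f k = ∑ σ : ι → ZMod q, (f σ : ℂ) * ZMod.stdAddChar (-∑ x, k x * σ x) := by
  refine Finset.sum_congr rfl fun σ _ => ?_
  have h : (-∑ x, k x * σ x : ZMod q) = ((-(∑ x, (k x).val * (σ x).val : ℕ) : ℤ) : ZMod q) := by
    push_cast
    simp only [ZMod.natCast_zmod_val]
  rw [h, ZMod.stdAddChar_coe]
  congr 3
  push_cast
  ring

lemma sum_stdAddChar_pairing (w : ι → ZMod q) :
    ∑ k : ι → ZMod q, ZMod.stdAddChar (∑ x, k x * w x)
      = if w = 0 then (q : ℂ) ^ Fintype.card ι else 0 := by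
  simp only [AddChar.map_finset_sum]
  rw [← Fintype.piFinset_univ,
    ← Finset.prod_univ_sum (fun _ : ι => (Finset.univ : Finset (ZMod q)))
      fun x a => (ZMod.stdAddChar (a * w x) : ℂ)]
  simp only [AddChar.sum_mulShift _ (ZMod.isPrimitive_stdAddChar q), ZMod.card]
  split_ifs with h
  · simp [h]
  · obtain ⟨x, hx⟩ := Function.ne_iff.1 h
    exact Finset.prod_eq_zero (Finset.mem_univ x) (by
      rw [if_neg (show ¬ w x = 0 from hx), Nat.cast_zero])

lemma sum_ftPi_mul_stdAddChar (f : (ι → ZMod q) → ℝ) (w : ι → ZMod q) :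
    ∑ k, ftPi f k * ZMod.stdAddChar (∑ x, k x * w x) = (q : ℂ) ^ Fintype.card ι * f w := by
  simp only [ftPi_eq_sum_stdAddChar, Finset.sum_mul]
  rw [Finset.sum_comm, Finset.sum_eq_single w]
  · have h : ∀ k : ι → ZMod q, (f w : ℂ) * ZMod.stdAddChar (-∑ x, k x * w x)
        * ZMod.stdAddChar (∑ x, k x * w x) = f w := fun k => by
      rw [mul_assoc, ← AddChar.map_add_eq_mul]
      simp
    simp [h]
  · intro σ _ hσ
    have h : ∀ k : ι → ZMod q, (f σ : ℂ) * ZMod.stdAddChar (-∑ x, k x * σ x)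
        * ZMod.stdAddChar (∑ x, k x * w x)
          = f σ * ZMod.stdAddChar (∑ x, k x * (w - σ) x) := fun k => by
      rw [mul_assoc, ← AddChar.map_add_eq_mul]
      simp only [Pi.sub_apply, mul_sub, Finset.sum_sub_distrib]
      rw [neg_add_eq_sub]
    simp only [h]
    rw [← Finset.mul_sum, sum_stdAddChar_pairing, if_neg (sub_ne_zero.2 hσ.symm), mul_zero]
  · simp

/-- A real function with nonnegative Fourier transform is positive definite. -/
theorem isPosDefFun_of_ftPi_nonneg {f : (ι → ZMod q) → ℝ}
    (hf : ∀ k, 0 ≤ (ftPi f k).re ∧ (ftPi f k).im = 0) : IsPosDefFun f := by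
  have hq : (0 : ℝ) < (q : ℝ) ^ Fintype.card ι := by
    have : (0 : ℝ) < q := by exact_mod_cast NeZero.pos q
    positivity
  have hreal : ∀ k, ftPi f k = ((ftPi f k).re : ℂ) := fun k =>
    Complex.ext rfl (by simpa using (hf k).2)
  have heven : ∀ w, f (-w) = f w := fun w => by
    have h1 := sum_ftPi_mul_stdAddChar f (-w)
    have h2 := congrArg (starRingEnd ℂ) (sum_ftPi_mul_stdAddChar f w)
    have h3 : ∑ k, ftPi f k * ZMod.stdAddChar (∑ x, k x * (-w) x)
        = starRingEnd ℂ (∑ k, ftPi f k * ZMod.stdAddChar (∑ x, k x * w x)) := by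
      rw [map_sum]
      refine Finset.sum_congr rfl fun k _ => ?_
      rw [map_mul, ← AddChar.map_neg_eq_conj, hreal k, Complex.conj_ofReal]
      simp
    rw [h1, h2] at h3
    simp only [map_mul, map_pow, Complex.conj_natCast, Complex.conj_ofReal] at h3
    exact mul_left_cancel₀ hq.ne' (by exact_mod_cast h3)
  refine posSemidef_real_iff.2 ⟨fun u v => ?_, fun x => ?_⟩
  · simp only [Matrix.of_apply]
    rw [← heven, neg_sub]
  · simp only [Matrix.of_apply]
    have key : (((q : ℝ) ^ Fintype.card ι * ∑ u, ∑ v, x u * x v * f (u - v) : ℝ) : ℂ)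
        = ((∑ k, (ftPi f k).re *
          Complex.normSq (∑ u, (x u : ℂ) * ZMod.stdAddChar (∑ i, k i * u i)) : ℝ) : ℂ) := by
      have hk : ∀ k : ι → ZMod q,
          (Complex.normSq (∑ u, (x u : ℂ) * ZMod.stdAddChar (∑ i, k i * u i)) : ℂ)
            = ∑ u : ι → ZMod q, ∑ v : ι → ZMod q,
              x u * x v * ZMod.stdAddChar (∑ i, k i * (u - v) i) := fun k => by
        rw [← Complex.mul_conj, map_sum, Finset.sum_mul_sum]
        refine Finset.sum_congr rfl fun u _ => Finset.sum_congr rfl fun v _ => ?_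
        rw [map_mul, Complex.conj_ofReal, ← AddChar.map_neg_eq_conj, mul_mul_mul_comm,
          ← AddChar.map_add_eq_mul]
        simp only [Pi.sub_apply, mul_sub, Finset.sum_sub_distrib]
        rw [sub_eq_add_neg]
      have huv : ∀ u v : ι → ZMod q, (q : ℂ) ^ Fintype.card ι * (x u * x v * f (u - v))
          = ∑ k, ftPi f k * (x u * x v * ZMod.stdAddChar (∑ i, k i * (u - v) i)) := fun u v => by
        rw [mul_left_comm, ← sum_ftPi_mul_stdAddChar, Finset.mul_sum]
        exact Finset.sum_congr rfl fun k _ => by ring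
      push_cast
      simp only [hk, ← hreal, Finset.mul_sum, huv]
      symm
      rw [Finset.sum_comm]
      refine Finset.sum_congr rfl fun v _ => ?_
      rw [Finset.sum_comm]
    have h2 : 0 ≤ (q : ℝ) ^ Fintype.card ι * ∑ u, ∑ v, x u * x v * f (u - v) := by
      rw [Complex.ofReal_inj.1 key]
      exact Finset.sum_nonneg fun k _ => mul_nonneg (hf k).1 (Complex.normSq_nonneg _)
    exact nonneg_of_mul_nonneg_right h2 hq

lemma isPosDefFun_of_ftZMod_nonneg {φ : ZMod q → ℝ}
    (hφ : ∀ k, 0 ≤ (ftZMod φ k).re ∧ (ftZMod φ k).im = 0) : IsPosDefFun φ := by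
  have h : ∀ k : Unit → ZMod q, ftPi (fun σ : Unit → ZMod q => φ (σ ())) k
      = ftZMod φ (k ()) := fun k => by
    rw [ftPi, ftZMod, ← Equiv.sum_comp (Equiv.funUnique Unit (ZMod q))]
    simp
  have := isPosDefFun_of_ftPi_nonneg (f := fun σ : Unit → ZMod q => φ (σ ()))
    fun k => by rw [h]; exact hφ _
  exact this.comp_hom (AddMonoidHom.mk' (fun a _ => a) fun _ _ => rfl)

end Fourier

section Couplings

variable {d : ℕ}

lemma norm_le_l1 (x : Zd d) : ‖(fun i => (x i : ℝ))‖ ≤ l1 x := by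
  refine (pi_norm_le_iff_of_nonneg ?_).2 fun i => ?_
  · exact_mod_cast Finset.sum_nonneg fun i _ => abs_nonneg (x i)
  · rw [Real.norm_eq_abs]
    exact_mod_cast Finset.single_le_sum (fun i _ => abs_nonneg (x i)) (Finset.mem_univ i)

lemma intCast_mem_span_basisFun (x : Zd d) :
    (fun i => (x i : ℝ)) ∈ Submodule.span ℤ (Set.range (Pi.basisFun ℝ (Fin d))) := by
  rw [Module.Basis.mem_span_iff_repr_mem]
  intro i
  simp

lemma summable_norm_rpow_span_basisFun {r : ℝ} (hr : r < -d) :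
    Summable fun z : Submodule.span ℤ (Set.range (Pi.basisFun ℝ (Fin d))) =>
      ‖(z : Fin d → ℝ)‖ ^ r := by
  refine ZLattice.summable_norm_rpow _ r ?_
  rw [ZLattice.rank ℝ]
  simpa using hr

lemma summable_sup_norm_rpow {r : ℝ} (hr : r < -d) :
    Summable fun x : Zd d => ‖(fun i => (x i : ℝ))‖ ^ r := by
  have hinj : Function.Injective fun x : Zd d =>
      (⟨fun i => (x i : ℝ), intCast_mem_span_basisFun x⟩ :
        Submodule.span ℤ (Set.range (Pi.basisFun ℝ (Fin d)))) := by
    intro x y hxy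
    funext i
    exact Int.cast_injective (α := ℝ) (congrFun (congrArg Subtype.val hxy) i)
  have h := (summable_norm_rpow_span_basisFun hr).comp_injective hinj
  simpa only [Function.comp_def] using h

lemma Jcoup_nonneg {J : ℝ} (hJ : 0 ≤ J) (α : ℝ) (x y : Zd d) : 0 ≤ Jcoup d J α x y := by
  unfold Jcoup
  split_ifs
  · exact le_rfl
  · have : (0 : ℝ) ≤ l1 (x - y) := by
      exact_mod_cast Finset.sum_nonneg fun i _ => abs_nonneg ((x - y) i)
    positivity

lemma Jcoup_comm (J α : ℝ) (x y : Zd d) : Jcoup d J α x y = Jcoup d J α y x := by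
  have : l1 (x - y) = l1 (y - x) := Finset.sum_congr rfl fun i _ => abs_sub_comm (x i) (y i)
  simp only [Jcoup, this, eq_comm (a := x)]

lemma summable_Jcoup {J α : ℝ} (hJ : 0 ≤ J) (hα : (d : ℝ) < α) (x : Zd d) :
    Summable fun y => Jcoup d J α x y := by
  have hs := ((summable_sup_norm_rpow (d := d) (r := -α) (by linarith)).comp_injective
    (sub_right_injective (b := x))).mul_left J
  refine Summable.of_nonneg_of_le (fun y => Jcoup_nonneg hJ α x y) (fun y => ?_) hs
  unfold Jcoup
  simp only [Function.comp]
  split_ifs with h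
  · positivity
  · have hpos : 0 < ‖(fun i => (((x - y) i : ℤ) : ℝ))‖ := by
      refine norm_pos_iff.2 fun h0 => h ?_
      funext i
      have := congrFun h0 i
      simp only [Pi.zero_apply, Int.cast_eq_zero, Pi.sub_apply, sub_eq_zero] at this
      exact this
    rw [Real.rpow_neg hpos.le, ← div_eq_mul_inv]
    have := norm_le_l1 (x - y)
    have hα0 : 0 ≤ α := (Nat.cast_nonneg d).trans hα.le
    gcongr

end Couplings

section Hamiltonian

variable {d q : ℕ}

/-- Evaluation at `x` of the extended configuration, as a group homomorphism. -/
def extendCfgHom (q : ℕ) (Λ : Finset (Zd d)) (x : Zd d) : (Λ → ZMod q) →+ ZMod q :=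
  AddMonoidHom.mk' (fun σ => extendCfg Λ σ x) fun σ τ => by
    unfold extendCfg
    split_ifs <;> simp

/-- The total coupling of the site `x` to the complement of `Λ`. -/
noncomputable def exteriorCoupling (J α : ℝ) (Λ : Finset (Zd d)) (x : Zd d) : ℝ :=
  ∑' y : Zd d, if y ∈ Λ then 0 else Jcoup d J α x y

lemma exteriorCoupling_nonneg {J : ℝ} (hJ : 0 ≤ J) (α : ℝ) (Λ : Finset (Zd d)) (x : Zd d) :
    0 ≤ exteriorCoupling J α Λ x := by
  refine tsum_nonneg fun y => ?_
  split_ifs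
  exacts [le_rfl, Jcoup_nonneg hJ α x y]

lemma exteriorCoupling_eq_add {J α : ℝ} (hJ : 0 ≤ J) (hα : (d : ℝ) < α) {Λ Δ : Finset (Zd d)}
    (hsub : Λ ⊆ Δ) (x : Zd d) :
    exteriorCoupling J α Λ x = exteriorCoupling J α Δ x + ∑ y ∈ Δ \ Λ, Jcoup d J α x y := by
  have h1 : Summable fun y => if y ∈ Δ then 0 else Jcoup d J α x y := by
    refine (summable_Jcoup hJ hα x).of_nonneg_of_le (fun y => ?_) (fun y => ?_)
    all_goals
      split_ifs
      · simp [Jcoup_nonneg hJ]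
      · simp [Jcoup_nonneg hJ]
  have h2 : HasSum (fun y => if y ∈ Δ \ Λ then Jcoup d J α x y else 0)
      (∑ y ∈ Δ \ Λ, Jcoup d J α x y) := by
    rw [← Finset.sum_congr rfl fun y hy => if_pos (c := y ∈ Δ \ Λ) (e := (0 : ℝ)) hy]
    exact hasSum_sum_of_ne_finset_zero fun y hy => if_neg hy
  have h3 : ∀ y, (if y ∈ Λ then 0 else Jcoup d J α x y)
      = (if y ∈ Δ then 0 else Jcoup d J α x y)
        + if y ∈ Δ \ Λ then Jcoup d J α x y else 0 := fun y => by
    by_cases hΛ : y ∈ Λ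
    · simp [hΛ, hsub hΛ]
    · by_cases hΔ : y ∈ Δ <;> simp [hΛ, hΔ]
  rw [exteriorCoupling, tsum_congr h3]
  exact (h1.hasSum.add h2).tsum_eq

lemma hamField_eq (J α : ℝ) (φ : ZMod q → ℝ) (Λ : Finset (Zd d)) (h : Λ → ℝ)
    (σ : Zd d → ZMod q) :
    hamField d q J α φ Λ h σ =
      -(1 / 2) * (∑ x ∈ Λ, ∑ y ∈ Λ, Jcoup d J α x y * φ (σ x - σ y))
        - ∑ x ∈ Λ, exteriorCoupling J α Λ x * φ (σ x) - ∑ x ∈ Λ.attach, h x * φ (σ x) := by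
  have hx : ∀ x : Zd d, (∑' y : Zd d, (if y ∈ Λ then 0 else Jcoup d J α x y * φ (σ x)))
      = exteriorCoupling J α Λ x * φ (σ x) := fun x => by
    rw [exteriorCoupling, ← tsum_mul_right]
    simp only [ite_mul, zero_mul]
  rw [hamField]
  simp only [hx]
  rw [Finset.sum_attach Λ fun x => exteriorCoupling J α Λ x * φ (σ x)]

lemma hamField_update_field (J α : ℝ) (φ : ZMod q → ℝ) (Λ : Finset (Zd d)) {h h' : Λ → ℝ} (z : Λ)
    (hne : ∀ x, x ≠ z → h x = h' x) (σ : Zd d → ZMod q) :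
    hamField d q J α φ Λ h' σ = hamField d q J α φ Λ h σ - (h' z - h z) * φ (σ z) := by
  have hs : ∑ x ∈ Λ.attach, (h' x - h x) * φ (σ x) = (h' z - h z) * φ (σ z) :=
    Finset.sum_eq_single z (fun x _ hx => by rw [hne x hx, sub_self, zero_mul])
      fun hz => absurd (Finset.mem_attach Λ z) hz
  simp only [sub_mul, Finset.sum_sub_distrib] at hs
  rw [hamField, hamField]
  linarith

/-- Up to an additive constant, the Hamiltonian in `Δ` of a configuration vanishing outside
`Λ ⊆ Δ` is the Hamiltonian in `Λ`. -/
lemma exists_hamField_eq_add_const {J α : ℝ} (hJ : 0 ≤ J) (hα : (d : ℝ) < α) {φ : ZMod q → ℝ}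
    (heven : ∀ a, φ (-a) = φ a) {Λ Δ : Finset (Zd d)} (hsub : Λ ⊆ Δ) (h : Δ → ℝ) :
    ∃ C : ℝ, ∀ σ : Zd d → ZMod q, (∀ x ∉ Λ, σ x = 0) →
      hamField d q J α φ Δ h σ
        = hamField d q J α φ Λ (fun x => h ⟨x.1, hsub x.2⟩) σ + C := by
  let H : Zd d → ℝ := fun x => if hx : x ∈ Δ then h ⟨x, hx⟩ else 0
  have hH : ∀ x : Δ, h x = H x := fun x => by simp [H]
  refine ⟨-(1 / 2) * (∑ x ∈ Δ \ Λ, ∑ y ∈ Δ \ Λ, Jcoup d J α x y * φ 0)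
    - ∑ x ∈ Δ \ Λ, exteriorCoupling J α Δ x * φ 0 - ∑ x ∈ Δ \ Λ, H x * φ 0, fun σ hσ => ?_⟩
  have h0 : ∀ x ∈ Δ \ Λ, σ x = 0 := fun x hx => hσ x (Finset.mem_sdiff.1 hx).2
  simp only [hamField_eq, hH]
  rw [Finset.sum_attach Δ fun x => H x * φ (σ x), Finset.sum_attach Λ fun x => H x * φ (σ x)]
  have hfield : ∑ x ∈ Δ, H x * φ (σ x)
      = ∑ x ∈ Δ \ Λ, H x * φ 0 + ∑ x ∈ Λ, H x * φ (σ x) := by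
    rw [← Finset.sum_sdiff hsub]
    congr 1
    exact Finset.sum_congr rfl fun x hx => by rw [h0 x hx]
  have hext : ∑ x ∈ Δ, exteriorCoupling J α Δ x * φ (σ x)
      = ∑ x ∈ Δ \ Λ, exteriorCoupling J α Δ x * φ 0
        + ∑ x ∈ Λ, exteriorCoupling J α Δ x * φ (σ x) := by
    rw [← Finset.sum_sdiff hsub]
    congr 1
    exact Finset.sum_congr rfl fun x hx => by rw [h0 x hx]
  have hext' : ∑ x ∈ Λ, exteriorCoupling J α Λ x * φ (σ x)
      = ∑ x ∈ Λ, exteriorCoupling J α Δ x * φ (σ x)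
        + ∑ x ∈ Λ, ∑ y ∈ Δ \ Λ, Jcoup d J α x y * φ (σ x) := by
    rw [← Finset.sum_add_distrib]
    refine Finset.sum_congr rfl fun x _ => ?_
    rw [exteriorCoupling_eq_add hJ hα hsub, add_mul, Finset.sum_mul]
  have hpair : ∑ x ∈ Δ, ∑ y ∈ Δ, Jcoup d J α x y * φ (σ x - σ y)
      = ∑ x ∈ Δ \ Λ, ∑ y ∈ Δ \ Λ, Jcoup d J α x y * φ 0
        + 2 * ∑ x ∈ Λ, ∑ y ∈ Δ \ Λ, Jcoup d J α x y * φ (σ x)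
        + ∑ x ∈ Λ, ∑ y ∈ Λ, Jcoup d J α x y * φ (σ x - σ y) := by
    have hin : ∀ x ∈ Λ, ∑ y ∈ Δ, Jcoup d J α x y * φ (σ x - σ y)
        = ∑ y ∈ Δ \ Λ, Jcoup d J α x y * φ (σ x)
          + ∑ y ∈ Λ, Jcoup d J α x y * φ (σ x - σ y) := fun x _ => by
      rw [← Finset.sum_sdiff hsub]
      congr 1
      exact Finset.sum_congr rfl fun y hy => by rw [h0 y hy, sub_zero]
    have hout : ∀ x ∈ Δ \ Λ, ∑ y ∈ Δ, Jcoup d J α x y * φ (σ x - σ y)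
        = ∑ y ∈ Δ \ Λ, Jcoup d J α x y * φ 0
          + ∑ y ∈ Λ, Jcoup d J α y x * φ (σ y) := fun x hx => by
      rw [← Finset.sum_sdiff hsub]
      congr 1
      · exact Finset.sum_congr rfl fun y hy => by rw [h0 y hy, h0 x hx, sub_zero]
      · exact Finset.sum_congr rfl fun y _ => by
          rw [h0 x hx, zero_sub, heven, Jcoup_comm]
    rw [← Finset.sum_sdiff hsub, Finset.sum_congr rfl hin, Finset.sum_congr rfl hout,
      Finset.sum_add_distrib, Finset.sum_add_distrib, Finset.sum_comm (s := Δ \ Λ) (t := Λ)]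
    ring
  rw [hfield, hext, hext', hpair]
  ring

lemma isPosDefFun_neg_hamField {J β : ℝ} (hJ : 0 ≤ J) (hβ : 0 ≤ β) (α : ℝ) {φ : ZMod q → ℝ}
    (hφ : IsPosDefFun φ) (Λ : Finset (Zd d)) {h : Λ → ℝ} (hh : ∀ x, 0 ≤ h x) :
    IsPosDefFun fun σ : Λ → ZMod q => -(β * hamField d q J α φ Λ h (extendCfg Λ σ)) := by
  have hsite : ∀ x, IsPosDefFun fun σ : Λ → ZMod q => φ (extendCfg Λ σ x) := fun x =>
    hφ.comp_hom (extendCfgHom q Λ x)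
  have hbond : ∀ x y,
      IsPosDefFun fun σ : Λ → ZMod q => φ (extendCfg Λ σ x - extendCfg Λ σ y) := fun x y =>
    hφ.comp_hom (extendCfgHom q Λ x - extendCfgHom q Λ y)
  have hpair : IsPosDefFun fun σ : Λ → ZMod q => ∑ x ∈ Λ, ∑ y ∈ Λ,
      Jcoup d J α x y * φ (extendCfg Λ σ x - extendCfg Λ σ y) :=
    .sum _ fun x _ => .sum _ fun y _ => (hbond x y).const_mul (Jcoup_nonneg hJ α x y)
  have hext : IsPosDefFun fun σ : Λ → ZMod q => ∑ x ∈ Λ,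
      exteriorCoupling J α Λ x * φ (extendCfg Λ σ x) :=
    .sum _ fun x _ => (hsite x).const_mul (exteriorCoupling_nonneg hJ α Λ x)
  have hfield : IsPosDefFun fun σ : Λ → ZMod q => ∑ x ∈ Λ.attach, h x * φ (extendCfg Λ σ x) :=
    .sum _ fun x _ => (hsite x).const_mul (hh x)
  have key := (((hpair.const_mul one_half_pos.le).add hext).add hfield).const_mul hβ
  convert key using 2 with σ
  rw [hamField_eq]
  ring

lemma sum_exp_pos {ι : Type*} [Fintype ι] [Nonempty ι] (A : ι → ℝ) : 0 < ∑ σ, Real.exp (A σ) :=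
  Finset.sum_pos (fun _ _ => Real.exp_pos _) Finset.univ_nonempty

variable [NeZero q]

/-- Expectations of functions with nonnegative Fourier transform are monotone in the fields. -/
theorem expec_le_of_field_le {J β : ℝ} (hJ : 0 ≤ J) (hβ : 0 ≤ β) (α : ℝ) {φ : ZMod q → ℝ}
    (hφ : IsPosDefFun φ) {Λ : Finset (Zd d)} {f : (Λ → ZMod q) → ℝ} (hf : IsPosDefFun f) (z : Λ)
    {h h' : Λ → ℝ} (hh : ∀ x, 0 ≤ h x) (hne : ∀ x, x ≠ z → h x = h' x) (hz : h z ≤ h' z) :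
    expec d q J α β φ Λ h f ≤ expec d q J α β φ Λ h' f := by
  have hB : IsPosDefFun fun σ : Λ → ZMod q => β * (h' z - h z) * φ (extendCfg Λ σ z) :=
    (hφ.comp_hom (extendCfgHom q Λ z)).const_mul (mul_nonneg hβ (sub_nonneg.2 hz))
  have key := hf.ginibre hB.exp (isPosDefFun_neg_hamField hJ hβ α hφ Λ hh)
  have hexp : ∀ σ : Λ → ZMod q, Real.exp (-(β * hamField d q J α φ Λ h' (extendCfg Λ σ)))
      = Real.exp (β * (h' z - h z) * φ (extendCfg Λ σ z))
        * Real.exp (-(β * hamField d q J α φ Λ h (extendCfg Λ σ))) := fun σ => by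
    rw [hamField_update_field J α φ Λ z hne, ← Real.exp_add]
    congr 1
    ring
  rw [expec, expec, div_le_div_iff₀ (sum_exp_pos _) (sum_exp_pos _)]
  simpa only [hexp, mul_assoc] using key

/-- Expectations of functions with nonnegative Fourier transform decrease with the volume. -/
theorem expec_le_of_subset {J α β : ℝ} (hJ : 0 ≤ J) (hα : (d : ℝ) < α) (hβ : 0 ≤ β)
    {φ : ZMod q → ℝ} (hφ : IsPosDefFun φ) {Λ Δ : Finset (Zd d)} {f : (Λ → ZMod q) → ℝ}
    (hf : IsPosDefFun f) (hsub : Λ ⊆ Δ) {h : Δ → ℝ} (hh : ∀ x, 0 ≤ h x) :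
    expec d q J α β φ Δ h (fun σ : Δ → ZMod q => f (fun x : Λ => σ ⟨x.1, hsub x.2⟩))
      ≤ expec d q J α β φ Λ (fun x : Λ => h ⟨x.1, hsub x.2⟩) f := by
  let res : (Δ → ZMod q) →+ (Λ → ZMod q) :=
    AddMonoidHom.mk' (fun σ x => σ ⟨x.1, hsub x.2⟩) fun _ _ => rfl
  let off : (Δ → ZMod q) →+ ({x : Δ // x.1 ∉ Λ} → ZMod q) :=
    AddMonoidHom.mk' (fun σ x => σ x.1) fun _ _ => rfl
  let ext : (Λ → ZMod q) → (Δ → ZMod q) := fun τ x => extendCfg Λ τ x.1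
  have hres : ∀ τ, res (ext τ) = τ := fun τ => by
    funext x
    simp [res, ext, extendCfg]
  have hext : ∀ τ, extendCfg Δ (ext τ) = extendCfg Λ τ := fun τ => by
    funext x
    by_cases hx : x ∈ Δ
    · simp [extendCfg, ext, hx]
    · have hx' : x ∉ Λ := fun hx' => hx (hsub hx')
      simp [extendCfg, hx, hx']
  have hoff : ∀ τ, off (ext τ) = 0 := fun τ => by
    funext x
    simp [off, ext, extendCfg, x.2]
  have hsum : ∀ F : (Δ → ZMod q) → ℝ,
      ∑ σ, (if off σ = 0 then (1 : ℝ) else 0) * F σ = ∑ τ, F (ext τ) := fun F => by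
    symm
    refine Finset.sum_of_injOn ext (fun τ _ τ' _ hττ => ?_) (by simp) (fun σ _ hσ => ?_)
      fun τ _ => by simp [hoff]
    · rw [← hres τ, hττ, hres]
    · rw [if_neg, zero_mul]
      refine fun h0 => hσ ⟨res σ, by simp, ?_⟩
      funext x
      by_cases hx : x.1 ∈ Λ
      · simp [ext, extendCfg, hx, res]
      · simpa [ext, extendCfg, hx] using (show σ x = 0 from congrFun h0 ⟨x, hx⟩).symm
  obtain ⟨C, hC⟩ := exists_hamField_eq_add_const hJ hα hφ.even hsub h
  have hexp : ∀ τ : Λ → ZMod q, Real.exp (-(β * hamField d q J α φ Δ h (extendCfg Λ τ)))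
      = Real.exp (-(β * C)) * Real.exp (-(β * hamField d q J α φ Λ
          (fun x : Λ => h ⟨x.1, hsub x.2⟩) (extendCfg Λ τ))) := fun τ => by
    rw [hC (extendCfg Λ τ) fun x hx => by simp [extendCfg, hx], ← Real.exp_add]
    congr 1
    ring
  have key := (hf.comp_hom res).ginibre (IsPosDefFun.indicator_ker off)
    (isPosDefFun_neg_hamField hJ hβ α hφ Δ hh)
  simp only [mul_comm (f _) (ite _ _ _), mul_assoc] at key
  simp only [hsum, hres, hext, hexp, mul_left_comm (f _), ← Finset.mul_sum] at key
  rw [expec, expec, div_le_div_iff₀ (sum_exp_pos _) (sum_exp_pos _)]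
  refine le_of_mul_le_mul_left ?_ (Real.exp_pos (-(β * C)))
  calc _ = _ := mul_left_comm _ _ _
    _ ≤ _ := key
    _ = _ := mul_assoc _ _ _

end Hamiltonian

/-- **Monotonicity of expectations** (Proposition 2.12): for a local function `f` with
nonnegative Fourier transform, (1) `⟨f⟩^q_{Λ,β,h}` is non-decreasing in each field
variable `h_z`, and (2) expectations decrease when the volume increases:
`⟨f⟩^q_{Δ,β,h} ≤ ⟨f⟩^q_{Λ,β,h|_Λ}` for `Λ ⊆ Δ`. -/
theorem expectation_monotonicity
    (d q : ℕ) (hd : 2 ≤ d) [NeZero q] (hq : 2 ≤ q)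
    (α J β : ℝ) (hα : (d : ℝ) < α) (hJ : 0 < J) (hβ : 0 < β)
    (φ : ZMod q → ℝ) (hφ : ∀ k : ZMod q, 0 ≤ (ftZMod φ k).re ∧ (ftZMod φ k).im = 0)
    (Λ : Finset (Zd d)) (f : (Λ → ZMod q) → ℝ)
    (hf : ∀ k : Λ → ZMod q, 0 ≤ (ftPi f k).re ∧ (ftPi f k).im = 0) :
    ((∀ z : Λ, ∀ h h' : Λ → ℝ, (∀ x, 0 ≤ h x) → (∀ x, 0 ≤ h' x) →
        (∀ x, x ≠ z → h x = h' x) → h z ≤ h' z →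
        expec d q J α β φ Λ h f ≤ expec d q J α β φ Λ h' f) ∧
     (∀ Δ : Finset (Zd d), ∀ hsub : Λ ⊆ Δ, ∀ h : Δ → ℝ, (∀ x, 0 ≤ h x) →
        expec d q J α β φ Δ h
            (fun σ : Δ → ZMod q => f (fun x : Λ => σ ⟨x.1, hsub x.2⟩))
          ≤ expec d q J α β φ Λ (fun x : Λ => h ⟨x.1, hsub x.2⟩) f)) := by
  have hφ' := isPosDefFun_of_ftZMod_nonneg hφ
  have hf' := isPosDefFun_of_ftPi_nonneg hf
  exact ⟨fun z _ _ hh _ hne hz => expec_le_of_field_le hJ.le hβ.le α hφ' hf' z hh hne hz,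
    fun _ hsub _ hh => expec_le_of_subset hJ.le hα hβ.le hφ' hf' hsub hh⟩
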